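/- Let A be a bounded residuated lattice with ⊥ ≠ ⊤ having exactly one maximal implicative filter (i.e., A is local). Then A is directly indecomposable, i.e., every Boolean element of A equals ⊥ or ⊤. -/

import Mathlib

universe u

/-- A bounded (integral, commutative) residuated lattice: a bounded lattice
with a commutative monoid operation `mul` (with unit `⊤`) and a residuum
`himp` satisfying the residuation condition. -/
class BRL (α : Type u) extends Lattice α, BoundedOrder α where
  mul : α → α → α
  himp : α → α → α
  mul_comm : ∀ a b : α, mul a b = mul b a
  mul_assoc : ∀ a b c : α, mul (mul a b) c = mul a (mul b c)
  mul_top : ∀ a : α, mul a ⊤ = a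
  residuation : ∀ a b c : α, mul a b ≤ c ↔ a ≤ himp b c

namespace BRL

variable {α : Type u} [BRL α]

/-- `¬a := a → ⊥`. -/
def neg (a : α) : α := himp a ⊥

/-- `a + b := ¬(¬a · ¬b)`. -/
def add (a b : α) : α := neg (mul (neg a) (neg b))

/-- Powers: `a⁰ = ⊤`, `aⁿ⁺¹ = a · aⁿ`. -/
def pow (a : α) : ℕ → α
  | 0 => ⊤
  | n + 1 => mul a (pow a n)

/-- Multiples: `0.a = ⊥`, `(n+1).a = a + n.a`. -/
def nmul : ℕ → α → α
  | 0, _ => ⊥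
  | n + 1, a => add a (nmul n a)

/-- Implicative filter. -/
def IsFilter (F : Set α) : Prop :=
  ⊤ ∈ F ∧ (∀ a b : α, a ∈ F → a ≤ b → b ∈ F) ∧
    (∀ a b : α, a ∈ F → b ∈ F → mul a b ∈ F)

/-- The smallest implicative filter containing `S`. -/
def genFilter (S : Set α) : Set α := ⋂₀ {F : Set α | IsFilter F ∧ S ⊆ F}

/-- Maximal (proper) implicative filter. -/
def IsMaximal (M : Set α) : Prop :=
  IsFilter M ∧ M ≠ Set.univ ∧ ∀ G : Set α, IsFilter G → M ⊂ G → G = Set.univ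

/-- Prime (proper) implicative filter. -/
def IsPrime (P : Set α) : Prop :=
  IsFilter P ∧ P ≠ Set.univ ∧ ∀ a b : α, a ⊔ b ∈ P → a ∈ P ∨ b ∈ P

/-- Minimal prime implicative filter (minimal among prime implicative filters). -/
def IsMinimalPrime (P : Set α) : Prop :=
  IsPrime P ∧ ∀ Q : Set α, IsPrime Q → Q ⊆ P → Q = P

/-- The radical: intersection of all maximal implicative filters. -/
def Rad : Set α := {a : α | ∀ M : Set α, IsMaximal M → a ∈ M}

/-- Boolean (complemented) element. -/
def Boolean (b : α) : Prop := b ⊔ neg b = ⊤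

/-- Stone ultrafilter: an implicative filter generated by an ultrafilter of
the Boolean algebra of Boolean elements. -/
def IsStoneUltra (F : Set α) : Prop :=
  IsFilter F ∧ F = genFilter (F ∩ {b : α | Boolean b}) ∧ (⊥ : α) ∉ F ∧
    ∀ b : α, Boolean b → b ∈ F ∨ neg b ∈ F

theorem neg_mul_self (b : α) : mul (neg b) b = ⊥ :=
  le_bot_iff.1 ((residuation _ _ _).2 le_rfl)

theorem top_mul (a : α) : mul ⊤ a = a := by
  rw [mul_comm, mul_top]

theorem mul_le_mul {a b c d : α} (hab : a ≤ b) (hcd : c ≤ d) : mul a c ≤ mul b d := by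
  have h₁ : mul a c ≤ mul b c :=
    (residuation _ _ _).2 (hab.trans ((residuation _ _ _).1 le_rfl))
  have h₂ : mul c b ≤ mul d b :=
    (residuation _ _ _).2 (hcd.trans ((residuation _ _ _).1 le_rfl))
  rw [mul_comm c, mul_comm d] at h₂
  exact h₁.trans h₂

theorem le_mul_self_of_complement {c d : α} (hsup : c ⊔ d = ⊤) (hmul : mul d c = ⊥) :
    c ≤ mul c c := by
  have h : c ⊔ d ≤ himp c (mul c c) :=
    sup_le ((residuation _ _ _).1 le_rfl) ((residuation _ _ _).1 (hmul.le.trans bot_le))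
  rw [hsup] at h
  simpa only [top_mul] using (residuation _ _ _).2 h

theorem isFilter_Ici {c : α} (hc : c ≤ mul c c) : IsFilter (Set.Ici c) :=
  ⟨le_top, fun _ _ ha hab => le_trans ha hab, fun _ _ ha hb => hc.trans (mul_le_mul ha hb)⟩

theorem IsFilter.ne_univ_iff {F : Set α} (hF : IsFilter F) : F ≠ Set.univ ↔ ⊥ ∉ F := by
  refine not_congr ⟨fun h => h ▸ Set.mem_univ _, fun h => ?_⟩
  exact Set.eq_univ_of_forall fun x => hF.2.1 ⊥ x h bot_le

theorem IsFilter.exists_isMaximal {F : Set α} (hF : IsFilter F) (hbot : ⊥ ∉ F) :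
    ∃ M : Set α, IsMaximal M ∧ F ⊆ M := by
  obtain ⟨M, hFM, hM⟩ := zorn_subset_nonempty {G : Set α | IsFilter G ∧ ⊥ ∉ G}
    (fun c hcS hc hne => by
      refine ⟨⋃₀ c, ⟨⟨?_, ?_, ?_⟩, ?_⟩, fun s hs => Set.subset_sUnion_of_mem hs⟩
      · obtain ⟨G, hG⟩ := hne
        exact ⟨G, hG, (hcS hG).1.1⟩
      · rintro a b ⟨G, hG, ha⟩ hab
        exact ⟨G, hG, (hcS hG).1.2.1 a b ha hab⟩
      · rintro a b ⟨G, hG, ha⟩ ⟨H, hH, hb⟩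
        rcases hc.total hG hH with h | h
        · exact ⟨H, hH, (hcS hH).1.2.2 a b (h ha) hb⟩
        · exact ⟨G, hG, (hcS hG).1.2.2 a b ha (h hb)⟩
      · rintro ⟨G, hG, hb⟩
        exact (hcS hG).2 hb) F ⟨hF, hbot⟩
  refine ⟨M, ⟨hM.prop.1, hM.prop.1.ne_univ_iff.2 hM.prop.2, fun G hG hMG => ?_⟩, hFM⟩
  by_contra hne
  exact hMG.2 (hM.le_of_ge ⟨hG, hG.ne_univ_iff.1 hne⟩ hMG.1)

theorem exists_isMaximal_mem {c : α} (hc : c ≤ mul c c) (hne : c ≠ ⊥) :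
    ∃ M : Set α, IsMaximal M ∧ c ∈ M := by
  obtain ⟨M, hM, hsub⟩ :=
    (isFilter_Ici hc).exists_isMaximal fun h => hne (le_bot_iff.1 h)
  exact ⟨M, hM, hsub le_rfl⟩

theorem local_implies_di (hnt : (⊥ : α) ≠ ⊤)
    (hloc : ∃! M : Set α, IsMaximal M) :
    ∀ b : α, Boolean b → b = ⊥ ∨ b = ⊤ := by
  intro b hb
  have hb' : b ⊔ neg b = ⊤ := hb
  by_cases hbot : b = ⊥
  · exact Or.inl hbot
  by_cases hneg : neg b = ⊥
  · exact Or.inr (by simpa [hneg] using hb')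
  obtain ⟨M, hM, hbM⟩ :=
    exists_isMaximal_mem (le_mul_self_of_complement hb' (neg_mul_self b)) hbot
  obtain ⟨N, hN, hbN⟩ := exists_isMaximal_mem
    (le_mul_self_of_complement ((sup_comm _ _).trans hb')
      ((mul_comm _ _).trans (neg_mul_self b))) hneg
  rw [hloc.unique hN hM] at hbN
  have h := hM.1.2.2 _ _ hbN hbM
  rw [neg_mul_self] at h
  exact absurd h (hM.1.ne_univ_iff.1 hM.2.1)

end BRL
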